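/- For every integer k ≥ 2, the complete k-partite graph K_{4,2*(k-2),1}, with one part of size 4, k−2 parts of size 2, and one part of size 1, has choice number exactly k. -/

import Mathlib

/-- `G` has a proper coloring in which every vertex gets a color from its own list. -/
def ListColorable {V : Type*} (G : SimpleGraph V) (L : V → Finset ℕ) : Prop :=
  ∃ c : V → ℕ, (∀ v, c v ∈ L v) ∧ ∀ ⦃u w⦄, G.Adj u w → c u ≠ c w

/-- `G` is `k`-choosable: `L`-colorable for every list assignment with all lists of size ≥ `k`. -/
def Choosable {V : Type*} (G : SimpleGraph V) (k : ℕ) : Prop :=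
  ∀ L : V → Finset ℕ, (∀ v, k ≤ (L v).card) → ListColorable G L

theorem card_le_erase_succ (A : Finset ℕ) (c : ℕ) : A.card ≤ (A.erase c).card + 1 := by
  have := Finset.pred_card_le_card_erase (s := A) (a := c)
  omega

/-- Hall's theorem relative to a finset of vertices. -/
theorem hall_finset {β : Type} [DecidableEq β] (VV : Finset β) (t : β → Finset ℕ)
    (h : ∀ S ⊆ VV, S.card ≤ (S.biUnion t).card) :
    ∃ f : β → ℕ, (∀ v ∈ VV, f v ∈ t v) ∧ ∀ u ∈ VV, ∀ v ∈ VV, u ≠ v → f u ≠ f v := by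
  classical
  obtain ⟨f, hf, hm⟩ := (Finset.all_card_le_biUnion_card_iff_exists_injective
    (fun v : VV => t v.1)).1 (by
      intro S
      have h1 := h (S.map (Function.Embedding.subtype _)) (by
        intro v hv
        simp only [Finset.mem_map, Function.Embedding.subtype_apply] at hv
        obtain ⟨a, _, rfl⟩ := hv
        exact a.2)
      rw [Finset.card_map] at h1
      refine h1.trans (Finset.card_le_card ?_)
      intro c hc
      simp only [Finset.mem_biUnion, Finset.mem_map, Function.Embedding.subtype_apply] at hc ⊢
      obtain ⟨v, ⟨a, ha, rfl⟩, hc⟩ := hc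
      exact ⟨a, ha, hc⟩)
  refine ⟨fun v => if hv : v ∈ VV then f ⟨v, hv⟩ else 0, ?_, ?_⟩
  · intro v hv
    simpa [hv] using hm ⟨v, hv⟩
  · intro u hu v hv huv
    simp only [hu, hv, dif_pos]
    intro he
    exact huv (congrArg Subtype.val (hf he))

/-- The 4-part `R` (or a subset of it), the single vertex and the pairs indexed by `s`,
all colored with distinct colors. -/
theorem hall_pairs (s : Finset ℕ) (R : Finset (Fin 4)) (Y : Fin 4 → Finset ℕ)
    (T : ℕ → Bool → Finset ℕ) (W : Finset ℕ)
    (h1 : ∀ i ∈ s, ∀ A ⊆ R, A.card + 1 + 2 * s.card ≤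
      (T i false ∪ T i true ∪ A.biUnion Y).card)
    (h2 : ∀ A ⊆ R, A.Nonempty → A.card + s.card ≤ (A.biUnion Y).card)
    (h2' : ∀ A ⊆ R, A.Nonempty → A.card + s.card + 1 ≤ (A.biUnion Y ∪ W).card)
    (h3 : s.card + 1 ≤ W.card)
    (h4 : ∀ i ∈ s, ∀ b, s.card + 1 ≤ (T i b).card) :
    ∃ (x : Fin 4 → ℕ) (t : ℕ → Bool → ℕ) (w : ℕ),
      (∀ a ∈ R, x a ∈ Y a) ∧ (∀ i ∈ s, ∀ b, t i b ∈ T i b) ∧ w ∈ W ∧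
      (∀ a ∈ R, x a ≠ w) ∧ (∀ a ∈ R, ∀ i ∈ s, ∀ b, x a ≠ t i b) ∧
      (∀ i ∈ s, ∀ b, t i b ≠ w) ∧
      (∀ i ∈ s, ∀ j ∈ s, i ≠ j → ∀ b b', t i b ≠ t j b') := by
  classical
  let tt : Fin 4 ⊕ (Unit ⊕ (ℕ × Bool)) → Finset ℕ :=
    Sum.elim Y (Sum.elim (fun _ => W) (fun p => T p.1 p.2))
  let VV : Finset (Fin 4 ⊕ (Unit ⊕ (ℕ × Bool))) :=
    R.disjSum (Finset.univ.disjSum (s ×ˢ Finset.univ))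
  obtain ⟨f, hf, hinj⟩ := hall_finset VV tt (by
    intro S hS
    have hA : S.toLeft ⊆ R := by
      intro a ha
      have := hS (Finset.mem_toLeft.1 ha)
      simpa [VV] using this
    have hP : ∀ p ∈ S.toRight.toRight, p.1 ∈ s := by
      intro p hp
      have := hS (Finset.mem_toRight.1 (Finset.mem_toRight.1 hp))
      simpa [VV] using this
    have hc1 := Finset.card_toLeft_add_card_toRight (u := S)
    have hc2 := Finset.card_toLeft_add_card_toRight (u := S.toRight)
    have hU : S.toRight.toLeft.card ≤ 1 := by
      simpa using Finset.card_le_univ S.toRight.toLeft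
    have hsubA : S.toLeft.biUnion Y ⊆ S.biUnion tt := by
      intro c hc
      simp only [Finset.mem_biUnion] at hc ⊢
      obtain ⟨a, ha, hc⟩ := hc
      exact ⟨Sum.inl a, Finset.mem_toLeft.1 ha, hc⟩
    have hsubW : S.toRight.toLeft.Nonempty → W ⊆ S.biUnion tt := by
      rintro ⟨u, hu⟩ c hc
      simp only [Finset.mem_biUnion]
      exact ⟨_, Finset.mem_toRight.1 (Finset.mem_toLeft.1 hu), hc⟩
    have hsubT : ∀ p ∈ S.toRight.toRight, T p.1 p.2 ⊆ S.biUnion tt := by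
      intro p hp c hc
      simp only [Finset.mem_biUnion]
      exact ⟨_, Finset.mem_toRight.1 (Finset.mem_toRight.1 hp), hc⟩
    by_cases hpair : ∃ i, (i, false) ∈ S.toRight.toRight ∧ (i, true) ∈ S.toRight.toRight
    · obtain ⟨i, hi0, hi1⟩ := hpair
      have hPc : S.toRight.toRight.card ≤ 2 * s.card := by
        have : S.toRight.toRight ⊆ s ×ˢ (Finset.univ : Finset Bool) := by
          intro p hp
          simp [hP p hp]
        have := Finset.card_le_card this
        rw [Finset.card_product] at this
        simp at this
        omega
      have := h1 i (hP _ hi0) _ hA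
      have h5 := Finset.card_le_card (Finset.union_subset (Finset.union_subset
        (hsubT _ hi0) (hsubT _ hi1)) hsubA)
      simp only at h5
      omega
    · have hPc : S.toRight.toRight.card ≤ s.card := by
        refine Finset.card_le_card_of_injOn Prod.fst (fun p hp => hP p hp) ?_
        rintro ⟨i, b⟩ hb ⟨j, b'⟩ hb' (rfl : i = j)
        rw [Finset.mem_coe] at hb hb'
        push Not at hpair
        have := hpair i
        cases b <;> cases b' <;> simp_all
      by_cases hAn : S.toLeft.Nonempty
      · by_cases hUn : S.toRight.toLeft.Nonempty
        · have := h2' _ hA hAn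
          have h5 := Finset.card_le_card (Finset.union_subset hsubA (hsubW hUn))
          omega
        · have := h2 _ hA hAn
          have h5 := Finset.card_le_card hsubA
          rw [Finset.not_nonempty_iff_eq_empty] at hUn
          rw [hUn] at hc2
          simp at hc2
          omega
      · rw [Finset.not_nonempty_iff_eq_empty] at hAn
        rw [hAn, Finset.card_empty] at hc1
        by_cases hUn : S.toRight.toLeft.Nonempty
        · have h5 := Finset.card_le_card (hsubW hUn)
          omega
        · rw [Finset.not_nonempty_iff_eq_empty] at hUn
          rw [hUn, Finset.card_empty] at hc2
          rcases S.toRight.toRight.eq_empty_or_nonempty with he | ⟨p, hp⟩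
          · rw [he, Finset.card_empty] at hc2
            omega
          · have := Finset.card_le_card (hsubT p hp)
            have := h4 p.1 (hP p hp) p.2
            omega)
  refine ⟨fun a => f (Sum.inl a), fun i b => f (Sum.inr (Sum.inr (i, b))),
    f (Sum.inr (Sum.inl ())), ?_, ?_, ?_, ?_, ?_, ?_, ?_⟩
  · intro a ha
    exact hf (Sum.inl a) (by simp [VV, ha])
  · intro i hi b
    exact hf (Sum.inr (Sum.inr (i, b))) (by simp [VV, hi])
  · exact hf (Sum.inr (Sum.inl ())) (by simp [VV])
  · intro a ha
    exact hinj _ (by simp [VV, ha]) _ (by simp [VV]) (by simp)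
  · intro a ha i hi b
    exact hinj _ (by simp [VV, ha]) _ (by simp [VV, hi]) (by simp)
  · intro i hi b
    exact hinj _ (by simp [VV, hi]) _ (by simp [VV]) (by simp)
  · intro i hi j hj hij b b'
    exact hinj _ (by simp [VV, hi]) _ (by simp [VV, hj]) (by simp [hij])

/-- A list coloring of `K_{4,2*m,1}`, the pairs being indexed by `s`. -/
def GoodCol (s : Finset ℕ) (X : Fin 4 → Finset ℕ)
    (T : ℕ → Bool → Finset ℕ) (W : Finset ℕ) : Prop :=
  ∃ (x : Fin 4 → ℕ) (t : ℕ → Bool → ℕ) (w : ℕ),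
      (∀ a, x a ∈ X a) ∧ (∀ i ∈ s, ∀ b, t i b ∈ T i b) ∧ w ∈ W ∧
      (∀ a, x a ≠ w) ∧ (∀ a, ∀ i ∈ s, ∀ b, x a ≠ t i b) ∧
      (∀ i ∈ s, ∀ b, t i b ≠ w) ∧
      (∀ i ∈ s, ∀ j ∈ s, i ≠ j → ∀ b b', t i b ≠ t j b')

/-- Use color `c` on all vertices of the 4-part whose list contains it. -/
theorem good_of_merge (s : Finset ℕ) (X : Fin 4 → Finset ℕ)
    (T : ℕ → Bool → Finset ℕ) (W : Finset ℕ)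
    (hX : ∀ a, s.card + 2 ≤ (X a).card)
    (hT : ∀ i ∈ s, ∀ b, s.card + 2 ≤ (T i b).card)
    (hW : s.card + 2 ≤ W.card)
    (hd : ∀ i ∈ s, Disjoint (T i false) (T i true))
    (c : ℕ) (hc : (Finset.univ.filter (fun a => c ∉ X a)).card ≤ 2)
    (hab : ∀ a b, a ≠ b → c ∉ X a → c ∉ X b →
      s.card + 3 ≤ (X a ∪ X b ∪ W.erase c).card) : GoodCol s X T W := by
  classical
  have her : ∀ A : Finset ℕ, A.card ≤ (A.erase c).card + 1 := fun A =>
    card_le_erase_succ A c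
  obtain ⟨x, t, w, h1, h2, h3, h4, h5, h6, h7⟩ := hall_pairs s
    (Finset.univ.filter (fun a => c ∉ X a)) X (fun i b => (T i b).erase c) (W.erase c)
    (by
      intro i hi A hA
      have hA2 := (Finset.card_le_card hA).trans hc
      have hu : ((T i false ∪ T i true).erase c).card ≤
          ((T i false).erase c ∪ (T i true).erase c ∪ A.biUnion X).card := by
        apply Finset.card_le_card
        intro y hy
        simp only [Finset.mem_erase, Finset.mem_union] at hy ⊢
        tauto
      have := her (T i false ∪ T i true)
      rw [Finset.card_union_of_disjoint (hd i hi)] at this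
      have := hT i hi false
      have := hT i hi true
      omega)
    (by
      rintro A hA ⟨a, ha⟩
      have hA2 := (Finset.card_le_card hA).trans hc
      have := Finset.card_le_card (Finset.subset_biUnion_of_mem X ha)
      have := hX a
      omega)
    (by
      rintro A hA hn
      have hA2 := (Finset.card_le_card hA).trans hc
      by_cases h1 : A.card ≤ 1
      · obtain ⟨a, ha⟩ := hn
        have := Finset.card_le_card (Finset.subset_biUnion_of_mem X ha)
        have := hX a
        have := Finset.card_le_card
          (Finset.subset_union_left (s₁ := A.biUnion X) (s₂ := W.erase c))
        omega
      · obtain ⟨a, b, hne, hAe⟩ := Finset.card_eq_two.1 (by omega : A.card = 2)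
        have ha : c ∉ X a := by
          have := hA (by rw [hAe]; simp : a ∈ A)
          simpa using this
        have hb : c ∉ X b := by
          have := hA (by rw [hAe]; simp : b ∈ A)
          simpa using this
        have := hab a b hne ha hb
        have h9 : A.biUnion X = X a ∪ X b := by
          rw [hAe]; ext; simp
        rw [h9]
        omega)
    (by have := her W; omega)
    (by intro i hi b; have := her (T i b); have := hT i hi b; omega)
  refine ⟨fun a => if c ∈ X a then c else x a, t, w, ?_, ?_, ?_, ?_, ?_, h6, h7⟩
  · intro a
    by_cases h : c ∈ X a
    · simp [h]
    · simpa [h] using h1 a (by simp [h])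
  · intro i hi b
    exact Finset.mem_of_mem_erase (h2 i hi b)
  · exact Finset.mem_of_mem_erase h3
  · intro a
    by_cases h : c ∈ X a
    · simpa [h] using (Finset.ne_of_mem_erase h3).symm
    · simpa [h] using h4 a (by simp [h])
  · intro a i hi b
    by_cases h : c ∈ X a
    · simpa [h] using (Finset.ne_of_mem_erase (h2 i hi b)).symm
    · simpa [h] using h5 a (by simp [h]) i hi b

/-- The case where the lists in each pair are disjoint. -/
theorem good_of_disjoint (s : Finset ℕ) (hs : 1 ≤ s.card) (X : Fin 4 → Finset ℕ)
    (T : ℕ → Bool → Finset ℕ) (W : Finset ℕ)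
    (hX : ∀ a, s.card + 2 ≤ (X a).card)
    (hT : ∀ i ∈ s, ∀ b, s.card + 2 ≤ (T i b).card)
    (hW : s.card + 2 ≤ W.card)
    (hd : ∀ i ∈ s, Disjoint (T i false) (T i true)) : GoodCol s X T W := by
  classical
  by_contra hno
  -- every color of multiplicity at least two is blocked
  have key : ∀ c, (Finset.univ.filter (fun a => c ∉ X a)).card ≤ 2 →
      ∃ a b, a ≠ b ∧ c ∉ X a ∧ c ∉ X b ∧ X a = X b ∧ W.erase c ⊆ X a := by
    intro c hc
    by_contra hcon
    apply hno
    refine good_of_merge s X T W hX hT hW hd c hc ?_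
    intro a b hne ha hb
    by_contra hlt
    apply hcon
    have e1 : X a = X a ∪ X b ∪ W.erase c := Finset.eq_of_subset_of_card_le
      (by intro y; simp; tauto) (by have := hX a; omega)
    have e2 : X b = X a ∪ X b ∪ W.erase c := Finset.eq_of_subset_of_card_le
      (by intro y; simp; tauto) (by have := hX b; omega)
    refine ⟨a, b, hne, ha, hb, e1.trans e2.symm, ?_⟩
    rw [e1]
    exact Finset.subset_union_right
  -- four distinct indices with two in the complement
  have two : ∀ (c : ℕ) (a b : Fin 4), a ≠ b → c ∈ X a → c ∈ X b →
      (Finset.univ.filter (fun a => c ∉ X a)).card ≤ 2 := by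
    intro c a b hne ha hb
    have : (Finset.univ.filter (fun a => c ∉ X a)) ⊆ Finset.univ \ {a, b} := by
      intro y hy
      simp only [Finset.mem_filter, Finset.mem_univ, true_and, Finset.mem_sdiff,
        Finset.mem_insert, Finset.mem_singleton, not_or] at hy ⊢
      exact ⟨fun h => hy (h ▸ ha), fun h => hy (h ▸ hb)⟩
    refine (Finset.card_le_card this).trans ?_
    rw [Finset.card_sdiff_of_subset (Finset.subset_univ _), Finset.card_pair hne]
    simp
  by_cases hm : ∃ c a b, a ≠ b ∧ c ∈ X a ∧ c ∈ X b
  · obtain ⟨c, a0, b0, hne0, ha0, hb0⟩ := hm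
    obtain ⟨a, b, hne, ha, hb, hab, hWa⟩ := key c (two c a0 b0 hne0 ha0 hb0)
    obtain ⟨d, hda⟩ : (X a).Nonempty := Finset.card_pos.1 (by have := hX a; omega)
    have hdb : d ∈ X b := hab ▸ hda
    obtain ⟨a', b', hne', ha', hb', hab', hWa'⟩ := key d (two d a b hne hda hdb)
    have hcard : 0 < ((W.erase c).erase d).card := by
      have h1 := card_le_erase_succ W c
      have h2 := card_le_erase_succ (W.erase c) d
      omega
    obtain ⟨e, he⟩ := Finset.card_pos.1 hcard
    simp only [Finset.mem_erase] at he
    have hea : e ∈ X a := hWa (by simp [he])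
    have hea' : e ∈ X a' := hWa' (by simp [he])
    have heb : e ∈ X b := hab ▸ hea
    obtain ⟨p, q, hpq, hp, hq, -, -⟩ := key e (two e a b hne hea heb)
    have heb' : e ∈ X b' := hab' ▸ hea'
    have n1 : a' ≠ a := fun h => ha' (h ▸ hda)
    have n2 : a' ≠ b := fun h => ha' (h ▸ hdb)
    have n3 : b' ≠ a := fun h => hb' (h ▸ hda)
    have n4 : b' ≠ b := fun h => hb' (h ▸ hdb)
    have m1 : p ≠ a := fun h => hp (h ▸ hea)
    have m2 : p ≠ b := fun h => hp (h ▸ heb)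
    have m3 : p ≠ a' := fun h => hp (h ▸ hea')
    have m4 : p ≠ b' := fun h => hp (h ▸ heb')
    omega
  · -- all lists in the 4-part are pairwise disjoint
    apply hno
    push Not at hm
    have hbig : ∀ A : Finset (Fin 4), A.card * (s.card + 2) ≤ (A.biUnion X).card := by
      intro A
      rw [Finset.card_biUnion]
      · rw [← smul_eq_mul]
        exact Finset.card_nsmul_le_sum _ _ _ (fun a _ => hX a)
      · intro a _ b _ hne
        refine Finset.disjoint_left.2 ?_
        intro c h1 h2
        exact hm c a b hne h1 h2
    have hA4 : ∀ A : Finset (Fin 4), A.card ≤ 4 := fun A => by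
      simpa using Finset.card_le_univ A
    obtain ⟨x, t, w, h1, h2, h3, h4, h5, h6, h7⟩ := hall_pairs s Finset.univ X T W
      (by
        intro i hi A _
        have g1 := Finset.card_le_card
          (Finset.subset_union_left (s₁ := T i false ∪ T i true) (s₂ := A.biUnion X))
        have g2 := Finset.card_le_card
          (Finset.subset_union_right (s₁ := T i false ∪ T i true) (s₂ := A.biUnion X))
        rw [Finset.card_union_of_disjoint (hd i hi)] at g1
        have := hT i hi false
        have := hT i hi true
        have g3 := hbig A
        have := hA4 A
        by_cases h : A.card = 4
        · rw [h] at g3 ⊢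
          omega
        · omega)
      (by
        intro A _ hn
        have := hbig A
        have := Finset.card_pos.2 hn
        nlinarith)
      (by
        intro A _ hn
        have := hbig A
        have := Finset.card_pos.2 hn
        have := Finset.card_le_card
          (Finset.subset_union_left (s₁ := A.biUnion X) (s₂ := W))
        nlinarith)
      (by omega)
      (by intro i hi b; have := hT i hi b; omega)
    exact ⟨x, t, w, fun a => h1 a (Finset.mem_univ _), h2, h3,
      fun a => h4 a (Finset.mem_univ _), fun a => h5 a (Finset.mem_univ _), h6, h7⟩

theorem good_all (n : ℕ) : ∀ (s : Finset ℕ), s.card = n → ∀ (X : Fin 4 → Finset ℕ)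
    (T : ℕ → Bool → Finset ℕ) (W : Finset ℕ),
    (∀ a, n + 2 ≤ (X a).card) → (∀ i ∈ s, ∀ b, n + 2 ≤ (T i b).card) →
    n + 2 ≤ W.card → GoodCol s X T W := by
  classical
  induction n with
  | zero =>
    intro s hs X T W hX hT hW
    rw [Finset.card_eq_zero] at hs
    subst hs
    obtain ⟨w, hw⟩ : W.Nonempty := Finset.card_pos.1 (by omega)
    have : ∀ a, ∃ y ∈ X a, y ≠ w := fun a =>
      Finset.exists_mem_ne (by have := hX a; omega) w
    choose x hx hxw using this
    exact ⟨x, fun _ _ => 0, w, hx, by simp, hw, hxw, by simp, by simp, by simp⟩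
  | succ n ih =>
    intro s hs X T W hX hT hW
    by_cases hd : ∀ i ∈ s, Disjoint (T i false) (T i true)
    · exact good_of_disjoint s (by omega) X T W (by simpa [hs] using hX)
        (by simpa only [hs] using hT) (by simpa [hs] using hW) hd
    · push Not at hd
      obtain ⟨i, hi, hnd⟩ := hd
      obtain ⟨c, hc0, hc1⟩ := Finset.not_disjoint_iff.1 hnd
      have her : ∀ A : Finset ℕ, A.card ≤ (A.erase c).card + 1 := fun A =>
        card_le_erase_succ A c
      obtain ⟨x, t, w, h1, h2, h3, h4, h5, h6, h7⟩ := ih (s.erase i)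
        (by rw [Finset.card_erase_of_mem hi]; omega) (fun a => (X a).erase c)
        (fun i b => (T i b).erase c) (W.erase c)
        (by intro a; have := hX a; have := her (X a); omega)
        (by
          intro j hj b
          have := hT j (Finset.mem_of_mem_erase hj) b
          have := her (T j b)
          omega)
        (by have := her W; omega)
      have hc : ∀ b, c ∈ T i b := by
        intro b
        cases b <;> assumption
      refine ⟨x, fun j b => if j = i then c else t j b, w, ?_, ?_, ?_, h4, ?_, ?_, ?_⟩
      · exact fun a => Finset.mem_of_mem_erase (h1 a)
      · intro j hj b
        by_cases h : j = i
        · subst h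
          simpa using hc b
        · simpa [h] using Finset.mem_of_mem_erase (h2 j (by simp [h, hj]) b)
      · exact Finset.mem_of_mem_erase h3
      · intro a j hj b
        by_cases h : j = i
        · simpa [h] using Finset.ne_of_mem_erase (h1 a)
        · simpa [h] using h5 a j (by simp [h, hj]) b
      · intro j hj b
        by_cases h : j = i
        · simpa [h] using (Finset.ne_of_mem_erase h3).symm
        · simpa [h] using h6 j (by simp [h, hj]) b
      · intro j hj l hl hjl b b'
        by_cases h : j = i
        · have hl' : l ≠ i := fun h' => hjl (h.trans h'.symm)
          simpa [h, hl'] using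
            (Finset.ne_of_mem_erase (h2 l (by simp [hl', hl]) b')).symm
        · by_cases h' : l = i
          · simpa [h, h'] using Finset.ne_of_mem_erase (h2 j (by simp [h, hj]) b)
          · simpa [h, h'] using h7 j (by simp [h, hj]) l (by simp [h', hl]) hjl b b'

/-- `Ch(K_{4,2*(k-2),1}) = k` for `k ≥ 2`. -/
theorem choiceNumber_K4_2xk2_1 (k : ℕ) (hk : 2 ≤ k) :
    IsLeast {n | Choosable (SimpleGraph.completeMultipartiteGraph
      (fun i : Fin k => Fin (if i.val = 0 then 4
        else if i.val < k - 1 then 2 else 1))) n} k := by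
  classical
  constructor
  · intro L hL
    let sz : ℕ → ℕ := fun i => if i = 0 then 4 else if i < k - 1 then 2 else 1
    let L' : ℕ → ℕ → Finset ℕ := fun i j =>
      if h : i < k ∧ j < sz i then L ⟨⟨i, h.1⟩, ⟨j, h.2⟩⟩ else ∅
    have hL' : ∀ i j, i < k → j < sz i → k ≤ (L' i j).card := by
      intro i j hi hj
      simp only [L', hi, hj, and_self, dif_pos]
      exact hL _
    have hLL : ∀ v, L v = L' v.1.val v.2.val := by
      rintro ⟨⟨i, hi⟩, ⟨j, hj⟩⟩
      have : i < k ∧ j < sz i := ⟨hi, hj⟩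
      simp only [L', this, and_self, dif_pos]
    obtain ⟨x, t, w, h1, h2, h3, h4, h5, h6, h7⟩ := good_all (k - 2) (Finset.Ico 1 (k - 1))
      (by rw [Nat.card_Ico]; omega) (fun a => L' 0 a.val)
      (fun i b => L' i (if b then 1 else 0)) (L' (k - 1) 0)
      (by
        intro a
        have := hL' 0 a.val (by omega) (by simp [sz])
        omega)
      (by
        intro i hi b
        rw [Finset.mem_Ico] at hi
        have := hL' i (if b then 1 else 0) (by omega) (by
          have : i ≠ 0 := by omega
          simp only [sz, this, hi.2, if_true, if_false]
          split_ifs <;> omega)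
        omega)
      (by
        have := hL' (k - 1) 0 (by omega) (by
          simp only [sz]
          split_ifs <;> omega)
        omega)
    refine ⟨fun v => if v.1.val = 0 then x (Fin.ofNat 4 v.2.val)
      else if v.1.val < k - 1 then t v.1.val (decide (v.2.val = 1)) else w, ?_, ?_⟩
    · intro v
      rw [hLL]
      obtain ⟨⟨i, hi⟩, ⟨j, hj⟩⟩ := v
      simp only at hj ⊢
      by_cases hi0 : i = 0
      · subst hi0
        have := h1 (Fin.ofNat 4 j)
        simp only [if_true] at hj
        simpa [Nat.mod_eq_of_lt hj] using this
      · by_cases hik : i < k - 1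
        · simp only [hi0, hik, if_true, if_false] at hj ⊢
          have := h2 i (by rw [Finset.mem_Ico]; omega) (decide (j = 1))
          obtain rfl | rfl : j = 0 ∨ j = 1 := by omega
          · simpa using this
          · simpa using this
        · simp only [hi0, hik, if_false] at hj ⊢
          obtain rfl : j = 0 := by omega
          obtain rfl : i = k - 1 := by omega
          exact h3
    · rintro ⟨⟨i, hi⟩, ⟨j, hj⟩⟩ ⟨⟨i', hi'⟩, ⟨j', hj'⟩⟩ hadj
      have hne : i ≠ i' := by
        intro h
        simp [SimpleGraph.completeMultipartiteGraph] at hadj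
        exact hadj h
      have hmem : ∀ i, i ≠ 0 → i < k - 1 → i ∈ Finset.Ico 1 (k - 1) := by
        intro i _ _
        rw [Finset.mem_Ico]
        omega
      simp only
      by_cases p : i = 0
      · have p' : i' ≠ 0 := by omega
        by_cases q' : i' < k - 1
        · simpa only [p, p', q', if_true, if_false] using h5 _ _ (hmem _ p' q') _
        · simpa only [p, p', q', if_true, if_false] using h4 _
      · by_cases p' : i' = 0
        · by_cases q : i < k - 1
          · simpa only [p, p', q, if_true, if_false] using (h5 _ _ (hmem _ p q) _).symm
          · simpa only [p, p', q, if_true, if_false] using (h4 _).symm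
        · by_cases q : i < k - 1
          · by_cases q' : i' < k - 1
            · simpa only [p, p', q, q', if_true, if_false] using
                h7 _ (hmem _ p q) _ (hmem _ p' q') hne _ _
            · simpa only [p, p', q, q', if_true, if_false] using h6 _ (hmem _ p q) _
          · by_cases q' : i' < k - 1
            · simpa only [p, p', q, q', if_true, if_false] using
                (h6 _ (hmem _ p' q') _).symm
            · omega
  · intro n hn
    obtain ⟨c, hc, hadj⟩ := hn (fun _ => Finset.range n) (by simp)
    have hpos : ∀ i : Fin k, 0 < (if i.val = 0 then 4
        else if i.val < k - 1 then 2 else 1) := by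
      intro i
      split_ifs <;> omega
    have : (Finset.univ : Finset (Fin k)).card ≤ (Finset.range n).card := by
      refine Finset.card_le_card_of_injOn (fun i => c ⟨i, ⟨0, hpos i⟩⟩) ?_ ?_
      · intro i _
        exact hc _
      · intro i _ j _ hij
        by_contra hne
        exact hadj (by simpa [SimpleGraph.completeMultipartiteGraph] using hne) hij
    simpa using this
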